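/- Let k be an even positive integer and let X be a finite set with |X| ≥ 5. Then there is no k-consensus method on X, defined on profiles of binary trees (a family of functions φ_Y^k : RBP(Y)^k → RP(Y), one for each nonempty Y ⊆ X), that is regular and extension stable on binary trees. -/

import Mathlib

open Set

variable {α : Type*}

/-- `T` is the hierarchy of clusters of a rooted phylogenetic tree on the taxon set `X`:
a family of nonempty subsets of `X` containing `X` itself and all singletons, in which
any two members intersect trivially (`A ∩ B ∈ {∅, A, B}`). -/
def IsHierarchy (X : Set α) (T : Set (Set α)) : Prop :=
  (∀ C ∈ T, C ⊆ X ∧ C.Nonempty) ∧ X ∈ T ∧ (∀ x ∈ X, ({x} : Set α) ∈ T) ∧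
    ∀ A ∈ T, ∀ B ∈ T, A ∩ B = ∅ ∨ A ∩ B = A ∨ A ∩ B = B

/-- `RP X`: rooted phylogenetic trees on `X`, modeled as their hierarchies of clusters. -/
def RP (X : Set α) : Set (Set (Set α)) := {T | IsHierarchy X T}

/-- Restriction `T|_Y` of a tree to a subset `Y` of the taxa:
`T|_Y = {C ∩ Y : C ∈ T, C ∩ Y ≠ ∅}`. -/
def restrictTree (Y : Set α) (T : Set (Set α)) : Set (Set α) :=
  {D | ∃ C ∈ T, D = C ∩ Y ∧ (C ∩ Y).Nonempty}

/-- A tree is binary iff it is maximal in `(RP X, ⊆)`. -/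
def IsBinary (X : Set α) (T : Set (Set α)) : Prop :=
  T ∈ RP X ∧ ∀ T' ∈ RP X, T ⊆ T' → T' = T

/-- `RBP X`: rooted binary phylogenetic trees on `X`. -/
def RBP (X : Set α) : Set (Set (Set α)) := {T | IsBinary X T}

/-- Relabeling a tree along a map `σ`: `σ·T = {σ(C) : C ∈ T}`. -/
def mapTree (σ : α → α) (T : Set (Set α)) : Set (Set α) := (Set.image σ) '' T

def catY (a : α) (l : List α) : Set α := {t | t ∈ a :: l}

def cat (a : α) : List α → Set (Set α)
  | [] => {{a}}
  | x :: l => insert {x} (insert (catY a (x :: l)) (cat a l))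

theorem catY_cons (a x : α) (l : List α) : catY a (x :: l) = insert x (catY a l) := by
  ext t; simp [catY]; tauto

theorem cat_sub (a : α) (l : List α) : ∀ C ∈ cat a l, C ⊆ catY a l ∧ C.Nonempty := by
  induction l with
  | nil => intro C hC; simp [cat] at hC; subst hC; simp [catY]
  | cons x l ih =>
    intro C hC
    simp only [cat, Set.mem_insert_iff] at hC
    rcases hC with rfl | rfl | hC
    · simp [catY]
    · exact ⟨le_rfl, a, by simp [catY]⟩
    · exact ⟨(ih C hC).1.trans (by rw [catY_cons]; exact Set.subset_insert _ _), (ih C hC).2⟩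

theorem cat_top (a : α) (l : List α) : catY a l ∈ cat a l := by
  cases l with
  | nil => simp [cat, catY]
  | cons x l => simp [cat]

theorem cat_bin (a : α) (l : List α) (h : (a :: l).Nodup) : cat a l ∈ RBP (catY a l) := by
  induction l with
  | nil =>
    have e : catY a [] = {a} := by ext; simp [catY]
    rw [e]
    refine ⟨⟨?_, ?_, ?_, ?_⟩, ?_⟩
    · intro C hC; simp [cat] at hC; subst hC; simp
    · simp [cat]
    · simp [cat]
    · intro A hA B hB; simp [cat] at hA hB; subst hA hB; simp
    · intro T' hT' hs
      refine Set.Subset.antisymm ?_ hs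
      intro C hC
      have := hT'.1 C hC
      have h2 : C = {a} := (Set.Nonempty.subset_singleton_iff this.2).1 this.1
      simp [cat, h2]
  | cons x l ih =>
    have hx : x ∉ catY a l := by
      simp [catY] at h ⊢; tauto
    have hb := ih (by simp at h ⊢; tauto)
    obtain ⟨⟨b1, b2, b3, b4⟩, b5⟩ := hb
    have hc := cat_sub a (x :: l)
    have key : ∀ A ∈ cat a l, A ∩ {x} = ∅ := by
      intro A hA
      ext t; simp only [Set.mem_inter_iff, Set.mem_singleton_iff, Set.mem_empty_iff_false, iff_false]
      rintro ⟨h1, rfl⟩; exact hx ((b1 A hA).1 h1)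
    refine ⟨⟨hc, cat_top _ _, ?_, ?_⟩, ?_⟩
    · intro t ht
      rw [catY_cons] at ht
      rcases ht with rfl | ht
      · simp [cat]
      · simp [cat, b3 t ht]
    · intro A hA B hB
      have hA0 := hc A hA
      have hB0 := hc B hB
      simp only [cat, Set.mem_insert_iff] at hA hB
      rcases hA with rfl | rfl | hA
      · rcases hB with rfl | rfl | hB
        · simp
        · right; left; exact Set.inter_eq_left.2 hA0.1
        · left; rw [Set.inter_comm]; exact key B hB
      · right; right; exact Set.inter_eq_right.2 hB0.1
      · rcases hB with rfl | rfl | hB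
        · left; exact key A hA
        · right; left; exact Set.inter_eq_left.2 hA0.1
        · exact b4 A hA B hB
    · intro T' hT' hs
      refine Set.Subset.antisymm ?_ hs
      intro C hC
      obtain ⟨t1, t2, t3, t4⟩ := hT'
      have hYT : catY a l ∈ T' := hs (by simp [cat, cat_top])
      by_cases hxC : x ∈ C
      · rcases t4 C hC _ hYT with h1 | h1 | h1
        · have : C = {x} := by
            refine Set.Subset.antisymm ?_ (by simpa using hxC)
            intro t ht
            have := (t1 C hC).1 ht
            rw [catY_cons] at this
            rcases this with rfl | h2
            · simp
            · exact absurd (show t ∈ C ∩ catY a l from ⟨ht, h2⟩) (by simp [h1])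
          simp [cat, this]
        · rw [← h1] at hxC; exact absurd hxC.2 hx
        · have : C = catY a (x :: l) := by
            refine Set.Subset.antisymm (t1 C hC).1 ?_
            rw [catY_cons]
            rintro t (rfl | ht)
            · exact hxC
            · rw [← h1] at ht; exact ht.1
          simp [cat, this]
      · have hsub : ∀ D ∈ T', x ∉ D → D ⊆ catY a l := by
          intro D hD hxD t ht
          have := (t1 D hD).1 ht
          rw [catY_cons] at this
          rcases this with rfl | h2
          · exact absurd ht hxD
          · exact h2
        have := b5 {D | D ∈ T' ∧ x ∉ D} ⟨?_, ?_, ?_, ?_⟩ ?_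
        · have hm : C ∈ {D | D ∈ T' ∧ x ∉ D} := ⟨hC, hxC⟩
          rw [this] at hm
          simp [cat, hm]
        · intro D hD; exact ⟨hsub D hD.1 hD.2, (t1 D hD.1).2⟩
        · exact ⟨hYT, hx⟩
        · intro t ht
          refine ⟨t3 t (by rw [catY_cons]; exact Or.inr ht), ?_⟩
          rintro rfl; exact hx ht
        · intro A hA B hB; exact t4 A hA.1 B hB.1
        · intro D hD
          exact ⟨hs (by simp [cat, hD]), fun hh => hx ((b1 D hD).1 hh)⟩

theorem cat_restrict (a : α) {l' l : List α} (hl : l'.Sublist l) (h : (a :: l).Nodup) :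
    restrictTree (catY a l') (cat a l) = cat a l' := by
  induction hl with
  | slnil => ext D; simp [restrictTree, cat, catY]; 
  | @cons l' l x hl ih =>
    have ih := ih (by simp at h ⊢; tauto)
    have hs : catY a l' ⊆ catY a l := by
      intro t ht; simp [catY] at ht ⊢; rcases ht with h | h
      · exact Or.inl h
      · exact Or.inr (hl.subset h)
    have hx : x ∉ catY a l := by
      simp [catY] at h ⊢; tauto
    rw [← ih]
    ext D
    constructor
    · rintro ⟨C, hC, rfl, hne⟩
      simp only [cat, Set.mem_insert_iff] at hC
      rcases hC with rfl | rfl | hC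
      · obtain ⟨t, h1, h2⟩ := hne
        rw [Set.mem_singleton_iff] at h1; subst h1
        exact absurd (hs h2) hx
      · refine ⟨_, cat_top a l, ?_, ?_⟩
        · rw [Set.inter_eq_right.2 hs, Set.inter_eq_right.2]
          rw [catY_cons]; exact hs.trans (Set.subset_insert _ _)
        · rw [Set.inter_eq_right.2 hs]; exact ⟨a, by simp [catY]⟩
      · exact ⟨C, hC, rfl, hne⟩
    · rintro ⟨C, hC, rfl, hne⟩
      exact ⟨C, by simp [cat, hC], rfl, hne⟩
  | @cons_cons l' l x hl ih =>
    have ih := ih (by simp at h ⊢; tauto)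
    have hs : catY a l' ⊆ catY a l := by
      intro t ht; simp [catY] at ht ⊢; rcases ht with h | h
      · exact Or.inl h
      · exact Or.inr (hl.subset h)
    have hx : x ∉ catY a l := by
      simp [catY] at h ⊢; tauto
    have hsub := cat_sub a l
    have hI : ∀ C ∈ cat a l, C ∩ catY a (x :: l') = C ∩ catY a l' := by
      intro C hC
      rw [catY_cons]
      ext t
      constructor
      · rintro ⟨h1, rfl | h2⟩
        · exact absurd ((hsub C hC).1 h1) hx
        · exact ⟨h1, h2⟩
      · rintro ⟨h1, h2⟩; exact ⟨h1, Or.inr h2⟩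
    have e1 : ({x} : Set α) ∩ catY a (x :: l') = {x} := by
      rw [Set.inter_eq_left]; simp [catY]
    have e2 : catY a (x :: l) ∩ catY a (x :: l') = catY a (x :: l') := by
      rw [Set.inter_eq_right, catY_cons, catY_cons]; exact Set.insert_subset_insert hs
    ext D
    simp only [cat, Set.mem_insert_iff]
    rw [← ih]
    constructor
    · rintro ⟨C, hC, rfl, hne⟩
      simp only [cat, Set.mem_insert_iff] at hC
      rcases hC with rfl | rfl | hC
      · exact Or.inl e1
      · exact Or.inr (Or.inl e2)
      · rw [hI C hC] at hne ⊢
        exact Or.inr (Or.inr ⟨C, hC, rfl, hne⟩)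
    · rintro (rfl | rfl | ⟨C, hC, rfl, hne⟩)
      · exact ⟨{x}, by simp [cat], e1.symm, by rw [e1]; simp⟩
      · exact ⟨_, cat_top a (x :: l), e2.symm, by rw [e2]; exact ⟨a, by simp [catY]⟩⟩
      · refine ⟨C, by simp [cat, hC], ?_, ?_⟩ <;> rw [hI C hC]
        exact hne

theorem catY_map (σ : α → α) (a : α) (l : List α) :
    σ '' (catY a l) = catY (σ a) (l.map σ) := by
  ext t; simp [catY, eq_comm]

theorem cat_map (σ : α → α) (a : α) (l : List α) :
    mapTree σ (cat a l) = cat (σ a) (l.map σ) := by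
  induction l with
  | nil => simp [mapTree, cat]
  | cons x l ih =>
    rw [List.map_cons, cat, cat, ← ih, ← List.map_cons, ← catY_map]
    simp [mapTree, Set.image_insert_eq]

theorem catY_perm (a : α) {l l' : List α} (h : l.Perm l') : catY a l = catY a l' := by
  ext t; simp [catY, h.mem_iff]

def prof (k : ℕ) (T U : Set (Set α)) (i : Fin k) : Set (Set α) :=
  if i.val % 2 = 0 then T else U

theorem prof_rev (k : ℕ) (hk : Even k) (T U : Set (Set α)) :
    prof k T U ∘ Fin.revPerm = prof k U T := by
  funext i
  obtain ⟨m, rfl⟩ := hk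
  have := i.2
  simp only [prof, Function.comp, Fin.revPerm_apply, Fin.val_rev]
  split_ifs <;> first | rfl | (exfalso; omega)

theorem sub1 (p q r s : α) : [q, r, s].Sublist [p, q, r, s] := .cons _ (.refl _)
theorem sub2 (p q r s : α) : [p, r, s].Sublist [p, q, r, s] := .cons_cons _ (.cons _ (.refl _))
theorem sub3 (p q r s : α) : [p, q, s].Sublist [p, q, r, s] :=
  .cons_cons _ (.cons_cons _ (.cons _ (.refl _)))
theorem sub4 (p q r s : α) : [p, q, r].Sublist [p, q, r, s] :=
  .cons_cons _ (.cons_cons _ (.cons_cons _ (.cons _ (.refl _))))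

set_option maxHeartbeats 4000000 in
/-- The two-tree core of the argument. -/
theorem core (X : Set α) (F : Set α → Set (Set α) → Set (Set α) → Set (Set α))
    (h1 : ∀ Y : Set α, Y.Nonempty → Y ⊆ X → ∀ T ∈ RBP Y, ∀ U ∈ RBP Y, F Y T U ∈ RP Y)
    (h2 : ∀ Y : Set α, Y.Nonempty → Y ⊆ X → ∀ T ∈ RBP Y, F Y T T = T)
    (h3 : ∀ Y : Set α, Y.Nonempty → Y ⊆ X → ∀ T ∈ RBP Y, ∀ U ∈ RBP Y, F Y T U = F Y U T)
    (h4 : ∀ Y : Set α, Y.Nonempty → Y ⊆ X → ∀ σ : α → α, Set.InjOn σ Y → σ '' Y ⊆ X →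
      ∀ T ∈ RBP Y, ∀ U ∈ RBP Y,
        F (σ '' Y) (mapTree σ T) (mapTree σ U) = mapTree σ (F Y T U))
    (h5 : ∀ Y X' : Set α, Y.Nonempty → Y ⊆ X' → X' ⊆ X → ∀ T ∈ RBP X', ∀ U ∈ RBP X',
        F Y (restrictTree Y T) (restrictTree Y U) ⊆ restrictTree Y (F X' T U))
    (a b c d e : α) (hnd : [a, b, c, d, e].Nodup) (hX : ∀ t ∈ [a, b, c, d, e], t ∈ X) :
    False := by
  classical
  have ne : ∀ (w : α) l, (catY w l).Nonempty := fun w l => ⟨w, by simp [catY]⟩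
  -- clusters of the four-taxon consensus
  let N : Prop → α → α → α → α → Prop := fun p w x y z =>
    ∃ C ∈ F (catY w [z, y, x]) (cat w [z, y, x]) (cat w [y, x, z]),
      w ∈ C ∧ x ∈ C ∧ y ∉ C ∧ (z ∈ C ↔ p)
  have bin1 : ∀ w x y z : α, [w, x, y, z].Nodup → cat w [z, y, x] ∈ RBP (catY w [z, y, x]) := by
    intro w x y z h; apply cat_bin; simp at h ⊢; grind
  have bin2 : ∀ w x y z : α, [w, x, y, z].Nodup → cat w [y, x, z] ∈ RBP (catY w [z, y, x]) := by
    intro w x y z h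
    have : catY w [z, y, x] = catY w [y, x, z] := by ext t; simp [catY]; tauto
    rw [this]
    apply cat_bin; simp at h ⊢; grind
  have subX : ∀ w x y z : α, (∀ t ∈ [w, x, y, z], t ∈ X) → catY w [z, y, x] ⊆ X := by
    intro w x y z h t ht; apply h; simp [catY] at ht ⊢; tauto
  have claim1 : ∀ w x y z : α, [w, x, y, z].Nodup → (∀ t ∈ [w, x, y, z], t ∈ X) →
      N False w x y z ∨ N True w x y z := by
    intro w x y z hn hx
    have hYX : catY w [y, x] ⊆ catY w [z, y, x] := by
      rw [catY_cons w z]; exact Set.subset_insert _ _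
    have r := h5 (catY w [y, x]) _ (ne _ _) hYX (subX _ _ _ _ hx) _ (bin1 _ _ _ _ hn) _
      (bin2 _ _ _ _ hn)
    rw [cat_restrict w (by simp) (by clear * - hn; simp at hn ⊢; grind),
      cat_restrict w (by simp) (by clear * - hn; simp at hn ⊢; grind),
      h2 _ (ne _ _) (hYX.trans (subX _ _ _ _ hx)) _ (cat_bin _ _ (by clear * - hn; simp at hn ⊢; grind))] at r
    have hm : catY w [x] ∈ cat w [y, x] := by simp [cat]
    obtain ⟨C, hC, hE, -⟩ := r hm
    have hw : w ∈ C := (hE.subset (by simp [catY])).1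
    have hx' : x ∈ C := (hE.subset (by simp [catY])).1
    have hy : y ∉ C := by
      intro hy
      have : y ∈ catY w [x] := hE.superset ⟨hy, by simp [catY]⟩
      clear * - this hn; simp [catY] at this hn; grind
    by_cases hz : z ∈ C
    · exact Or.inr ⟨C, hC, hw, hx', hy, by simp [hz]⟩
    · exact Or.inl ⟨C, hC, hw, hx', hy, by simp [hz]⟩
  have claim2 : ∀ p w x y z w' x' y' z', [w, x, y, z].Nodup → (∀ t ∈ [w, x, y, z], t ∈ X) →
      [w', x', y', z'].Nodup → (∀ t ∈ [w', x', y', z'], t ∈ X) →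
      N p w x y z → N p w' x' y' z' := by
    intro p w x y z w' x' y' z' hn hx hn' hx' ⟨C, hC, cw, cx, cy, cz⟩
    let σ : α → α := fun t => if t = w then w' else if t = x then x' else if t = y then y' else z'
    have sw : σ w = w' := by simp [σ]
    have sx : σ x = x' := by simp at hn; simp [σ]; grind
    have sy : σ y = y' := by simp at hn; simp [σ]; grind
    have sz : σ z = z' := by simp at hn; simp [σ]; grind
    have inj : Set.InjOn σ (catY w [z, y, x]) := by
      intro s hs t ht hst
      clear * - hs ht hn hn' hst sw sx sy sz
      clear_value σ
      simp [catY] at hs ht hn hn'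
      rcases hs with rfl | rfl | rfl | rfl <;> rcases ht with rfl | rfl | rfl | rfl <;> grind
    have him : σ '' (catY w [z, y, x]) = catY w' [z', y', x'] := by
      rw [catY_map]; simp [sw, sx, sy, sz]
    have q := h4 _ (ne _ _) (subX _ _ _ _ hx) σ inj (him ▸ subX _ _ _ _ hx') _
      (bin1 _ _ _ _ hn) _ (bin2 _ _ _ _ hn)
    rw [him, cat_map, cat_map] at q
    simp only [List.map_cons, List.map_nil, sw, sx, sy, sz] at q
    have hCs := ((h1 _ (ne _ _) (subX _ _ _ _ hx) _
      (bin1 _ _ _ _ hn) _ (bin2 _ _ _ _ hn)).1 C hC).1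
    have imem : ∀ t ∈ catY w [z, y, x], (σ t ∈ σ '' C ↔ t ∈ C) := fun t ht =>
      inj.mem_image_iff hCs ht
    refine ⟨σ '' C, ?_, ?_, ?_, ?_, ?_⟩
    · rw [q]; exact ⟨C, hC, rfl⟩
    · rw [← sw, imem _ (by simp [catY])]; exact cw
    · rw [← sx, imem _ (by simp [catY])]; exact cx
    · rw [← sy, imem _ (by simp [catY])]; exact cy
    · rw [← sz, imem _ (by simp [catY])]; exact cz
  -- the five-taxon profile
  have B1 : cat a [e, d, c, b] ∈ RBP (catY a [e, d, c, b]) :=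
    cat_bin _ _ (by clear * - hnd; simp at hnd ⊢; grind)
  have B2 : cat a [c, b, e, d] ∈ RBP (catY a [e, d, c, b]) := by
    have : catY a [e, d, c, b] = catY a [c, b, e, d] := by ext t; simp [catY]; tauto
    rw [this]
    exact cat_bin _ _ (by clear * - hnd; simp at hnd ⊢; grind)
  have YX : catY a [e, d, c, b] ⊆ X := by
    intro t ht; apply hX; simp [catY] at ht ⊢; tauto
  have claim3 : ∀ p x y z, catY a [z, y, x] ⊆ catY a [e, d, c, b] →
      F (catY a [z, y, x]) (cat a [z, y, x]) (cat a [y, x, z]) ⊆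
        restrictTree (catY a [z, y, x]) (F (catY a [e, d, c, b]) (cat a [e, d, c, b])
          (cat a [c, b, e, d])) →
      N p a x y z →
      ∃ C ∈ F (catY a [e, d, c, b]) (cat a [e, d, c, b]) (cat a [c, b, e, d]),
        a ∈ C ∧ x ∈ C ∧ y ∉ C ∧ (z ∈ C ↔ p) := by
    intro p x y z hs hr ⟨C, hC, cw, cx, cy, cz⟩
    obtain ⟨D, hD, rfl, -⟩ := hr hC
    refine ⟨D, hD, cw.1, cx.1, fun h => cy ⟨h, by simp [catY]⟩, ?_⟩
    rw [← cz]
    exact ⟨fun h => ⟨h, by simp [catY]⟩, fun h => h.1⟩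
  have nd : [a, c, b, e, d].Nodup := by clear * - hnd; simp at hnd ⊢; grind
  have nd1 : (a :: [e, d, c, b]).Nodup := by clear * - hnd; simp at hnd ⊢; grind
  have nd2 : (a :: [c, b, e, d]).Nodup := by clear * - hnd; simp at hnd ⊢; grind
  have s1 : ∀ x y z : α, catY a [z, y, x] ⊆ catY a [e, d, c, b] →
      [z, y, x].Sublist [e, d, c, b] → [y, x, z].Sublist [c, b, e, d] →
      F (catY a [z, y, x]) (cat a [z, y, x]) (cat a [y, x, z]) ⊆
        restrictTree (catY a [z, y, x]) (F (catY a [e, d, c, b]) (cat a [e, d, c, b])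
          (cat a [c, b, e, d])) := by
    intro x y z hs l1 l2
    have r := h5 _ _ (ne a [z, y, x]) hs YX _ B1 _ B2
    have e2 : catY a [z, y, x] = catY a [y, x, z] := by ext t; simp [catY]; tauto
    rw [cat_restrict a l1 nd1] at r
    have e3 := cat_restrict a l2 nd2
    rw [← e2] at e3
    rwa [e3] at r
  have s2 : ∀ x y z : α, catY a [z, y, x] ⊆ catY a [e, d, c, b] →
      [z, y, x].Sublist [c, b, e, d] → [y, x, z].Sublist [e, d, c, b] →
      F (catY a [z, y, x]) (cat a [z, y, x]) (cat a [y, x, z]) ⊆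
        restrictTree (catY a [z, y, x]) (F (catY a [e, d, c, b]) (cat a [e, d, c, b])
          (cat a [c, b, e, d])) := by
    intro x y z hs l1 l2
    have r := h5 _ _ (ne a [z, y, x]) hs YX _ B2 _ B1
    have e2 : catY a [z, y, x] = catY a [y, x, z] := by ext t; simp [catY]; tauto
    rw [cat_restrict a l1 nd2] at r
    have e3 := cat_restrict a l2 nd1
    rw [← e2] at e3
    rw [e3] at r
    rwa [h3 _ (ne _ _) YX _ B1 _ B2]
  have ss : ∀ x y z : α, x ∈ [a, b, c, d, e] → y ∈ [a, b, c, d, e] → z ∈ [a, b, c, d, e] →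
      catY a [z, y, x] ⊆ catY a [e, d, c, b] := by
    clear * -
    intro x y z hx hy hz t ht
    simp [catY] at ht hx hy hz ⊢; grind
  have final : ∀ A ∈ F (catY a [e, d, c, b]) (cat a [e, d, c, b]) (cat a [c, b, e, d]),
      ∀ B ∈ F (catY a [e, d, c, b]) (cat a [e, d, c, b]) (cat a [c, b, e, d]),
      ∀ u v, a ∈ A → a ∈ B → u ∈ A → u ∉ B → v ∈ B → v ∉ A → False := by
    intro A hA B hB u v aA aB uA uB vB vA
    rcases (h1 _ (ne _ _) YX _ B1 _ B2).2.2.2 A hA B hB with h | h | h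
    · exact (h.subset ⟨aA, aB⟩ : a ∈ (∅ : Set α))
    · exact uB (h.superset uA).2
    · exact vA (h.superset vB).1
  have n0 : [a, b, c, d].Nodup := by clear * - hnd; simp at hnd ⊢; grind
  have x0 : ∀ t ∈ [a, b, c, d], t ∈ X := by intro t ht; apply hX; simp at ht ⊢; tauto
  rcases claim1 a b c d n0 x0 with h | h
  · have k2 := claim2 _ _ _ _ _ a d e b n0 x0 (by clear * - hnd; simp at hnd ⊢; grind)
      (by intro t ht; apply hX; simp at ht ⊢; tauto) h
    obtain ⟨A, hA, p1, p2, p3, p4⟩ := claim3 _ b c d (ss _ _ _ (by simp) (by simp) (by simp))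
      (s1 b c d (ss _ _ _ (by simp) (by simp) (by simp)) (sub1 ..) (sub3 ..)) h
    obtain ⟨B, hB, q1, q2, q3, q4⟩ := claim3 _ d e b (ss _ _ _ (by simp) (by simp) (by simp))
      (s2 d e b (ss _ _ _ (by simp) (by simp) (by simp)) (sub1 ..) (sub3 ..)) k2
    exact final A hA B hB b d p1 q1 p2 q4.1 q2 p4.1
  · have k1 := claim2 _ _ _ _ _ a b c e n0 x0 (by clear * - hnd; simp at hnd ⊢; grind)
      (by intro t ht; apply hX; simp at ht ⊢; tauto) h
    have k2 := claim2 _ _ _ _ _ a d e c n0 x0 (by clear * - hnd; simp at hnd ⊢; grind)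
      (by intro t ht; apply hX; simp at ht ⊢; tauto) h
    obtain ⟨A, hA, p1, p2, p3, p4⟩ := claim3 _ b c e (ss _ _ _ (by simp) (by simp) (by simp))
      (s1 b c e (ss _ _ _ (by simp) (by simp) (by simp)) (sub2 ..) (sub4 ..)) k1
    obtain ⟨B, hB, q1, q2, q3, q4⟩ := claim3 _ d e c (ss _ _ _ (by simp) (by simp) (by simp))
      (s2 d e c (ss _ _ _ (by simp) (by simp) (by simp)) (sub2 ..) (sub4 ..)) k2
    exact final A hA B hB e c p1 q1 (p4.2 trivial) q3 (q4.2 trivial) p3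

/-- For any finite taxon set `X` with at least 5 elements and any even
positive `k`, there is no `k`-consensus method on `X` defined on profiles of binary trees
(a family `φ Y : RBP(Y)^k → RP(Y)` for nonempty `Y ⊆ X`) that is regular (unanimous,
anonymous, neutral) and extension stable on binary trees. -/
theorem no_regular_extension_stable_k_method_on_binary_trees
    (X : Set α) (hXfin : X.Finite) (hX5 : 5 ≤ X.ncard)
    (k : ℕ) (hkpos : 0 < k) (hkeven : Even k) :
    ¬ ∃ φ : Set α → (Fin k → Set (Set α)) → Set (Set α),
      -- `φ Y` maps profiles of binary trees on `Y` to trees on `Y`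
      (∀ Y : Set α, Y.Nonempty → Y ⊆ X →
        ∀ Ts : Fin k → Set (Set α), (∀ i, Ts i ∈ RBP Y) → φ Y Ts ∈ RP Y) ∧
      -- unanimity
      (∀ Y : Set α, Y.Nonempty → Y ⊆ X →
        ∀ T ∈ RBP Y, φ Y (fun _ => T) = T) ∧
      -- anonymity
      (∀ Y : Set α, Y.Nonempty → Y ⊆ X →
        ∀ Ts : Fin k → Set (Set α), (∀ i, Ts i ∈ RBP Y) →
          ∀ π : Equiv.Perm (Fin k), φ Y (Ts ∘ π) = φ Y Ts) ∧
      -- neutrality: any bijection `σ : Y → Y'` between nonempty subsets of `X`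
      (∀ Y : Set α, Y.Nonempty → Y ⊆ X →
        ∀ σ : α → α, Set.InjOn σ Y → σ '' Y ⊆ X →
          ∀ Ts : Fin k → Set (Set α), (∀ i, Ts i ∈ RBP Y) →
            φ (σ '' Y) (fun i => mapTree σ (Ts i)) = mapTree σ (φ Y Ts)) ∧
      -- extension stability on binary trees
      (∀ Y X' : Set α, Y.Nonempty → Y ⊆ X' → X' ⊆ X →
        ∀ Ts : Fin k → Set (Set α), (∀ i, Ts i ∈ RBP X') →
          φ Y (fun i => restrictTree Y (Ts i)) ⊆ restrictTree Y (φ X' Ts)) := by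
  rintro ⟨φ, g1, g2, g3, g4, g5⟩
  have pm : ∀ (Y : Set α) (T U : Set (Set α)), T ∈ RBP Y → U ∈ RBP Y →
      ∀ i, prof k T U i ∈ RBP Y := by
    intro Y T U hT hU i; unfold prof; split_ifs <;> assumption
  have pf : ∀ (f : Set (Set α) → Set (Set α)) (T U : Set (Set α)),
      (fun i => f (prof k T U i)) = prof k (f T) (f U) := by
    intro f T U; funext i; unfold prof; split_ifs <;> rfl
  have hc : X.ncard = hXfin.toFinset.toList.length := by
    rw [Finset.length_toList, Set.ncard_eq_toFinset_card X hXfin]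
  have hnd := hXfin.toFinset.nodup_toList
  have hmem : ∀ t ∈ hXfin.toFinset.toList, t ∈ X := by simp
  rw [hc] at hX5
  generalize hXfin.toFinset.toList = L at *
  match L, hX5, hnd, hmem with
  | a :: b :: c :: d :: e :: L', _, hnd, hmem =>
    refine core X (fun Y T U => φ Y (prof k T U)) ?_ ?_ ?_ ?_ ?_ a b c d e ?_ ?_
    · intro Y hn hY T hT U hU
      exact g1 Y hn hY _ (pm Y T U hT hU)
    · intro Y hn hY T hT
      have : prof k T T = fun _ => T := by funext i; simp [prof]
      change φ Y (prof k T T) = T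
      rw [this]; exact g2 Y hn hY T hT
    · intro Y hn hY T hT U hU
      change φ Y (prof k T U) = φ Y (prof k U T)
      rw [← prof_rev k hkeven T U]
      exact (g3 Y hn hY _ (pm Y T U hT hU) _).symm
    · intro Y hn hY σ hσ hσX T hT U hU
      have := g4 Y hn hY σ hσ hσX _ (pm Y T U hT hU)
      rwa [pf] at this
    · intro Y X' hn hY hX' T hT U hU
      have := g5 Y X' hn hY hX' _ (pm X' T U hT hU)
      rwa [pf] at this
    · exact hnd.sublist (by simp)
    · intro t ht; apply hmem; simp at ht ⊢; tauto
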